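/- For $s \in (-d/2, d/2)$ and functions $f_1, \ldots, f_5 \in H^{(s+2d)/5}(\mathbb{T}^d)$, the product satisfies $\| f_1 f_2 f_3 f_4 f_5 \|_{H^s(\mathbb{T}^d)} \lesssim \prod_{j=1}^5 \| f_j \|_{H^{(s+2d)/5}(\mathbb{T}^d)}$. -/

import Mathlib

open scoped ENNReal

/-- Japanese bracket weight `⟨ξ⟩^{2s} = (1 + |ξ|²)^s` for `ξ ∈ ℤᵈ`. -/
noncomputable def sobWeight {d : ℕ} (s : ℝ) (ξ : Fin d → ℤ) : ℝ :=
  (1 + ∑ i, ((ξ i : ℝ)) ^ 2) ^ s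

/-- The `Hˢ(𝕋ᵈ)` norm via Fourier coefficients, valued in `ℝ≥0∞`. -/
noncomputable def sobNorm (d : ℕ) (s : ℝ) (f : (Fin d → ℤ) → ℂ) : ℝ≥0∞ :=
  (∑' ξ : Fin d → ℤ, ENNReal.ofReal (sobWeight s ξ * ‖f ξ‖ ^ 2)) ^ (1/2 : ℝ)

/-- Fourier coefficients of the product `f₁ f₂ f₃ f₄ f₅` on `𝕋ᵈ`:
the fivefold convolution. -/
noncomputable def quintProd (d : ℕ) (f₁ f₂ f₃ f₄ f₅ : (Fin d → ℤ) → ℂ) :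
    (Fin d → ℤ) → ℂ :=
  fun ξ => ∑' p : (Fin d → ℤ) × (Fin d → ℤ) × (Fin d → ℤ) × (Fin d → ℤ),
    f₁ p.1 * f₂ p.2.1 * f₃ p.2.2.1 * f₄ p.2.2.2 *
      f₅ (ξ - p.1 - p.2.1 - p.2.2.1 - p.2.2.2)

/-- The Japanese bracket `⟨ξ⟩ = (1 + |ξ|²)^{1/2}`. -/
noncomputable def bracket {d : ℕ} (ξ : Fin d → ℤ) : ℝ :=
  √(1 + ∑ i, (ξ i : ℝ) ^ 2)

lemma one_le_bracket {d : ℕ} (ξ : Fin d → ℤ) : 1 ≤ bracket ξ := by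
  rw [bracket, Real.one_le_sqrt]
  have : 0 ≤ ∑ i, (ξ i : ℝ) ^ 2 := by positivity
  linarith

lemma bracket_pos {d : ℕ} (ξ : Fin d → ℤ) : 0 < bracket ξ :=
  zero_lt_one.trans_le (one_le_bracket ξ)

lemma bracket_sq {d : ℕ} (ξ : Fin d → ℤ) : bracket ξ ^ 2 = 1 + ∑ i, (ξ i : ℝ) ^ 2 :=
  Real.sq_sqrt (by positivity)

lemma bracket_neg {d : ℕ} (ξ : Fin d → ℤ) : bracket (-ξ) = bracket ξ := by
  simp [bracket]

lemma bracket_add_le {d : ℕ} (ξ η : Fin d → ℤ) : bracket (ξ + η) ≤ bracket ξ + bracket η := by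
  have hcs : ∑ i, (ξ i : ℝ) * η i ≤ bracket ξ * bracket η := by
    refine (Real.sum_mul_le_sqrt_mul_sqrt _ _ _).trans ?_
    unfold bracket
    gcongr <;> linarith
  have hexp : bracket (ξ + η) ^ 2 =
      1 + ∑ i, (ξ i : ℝ) ^ 2 + ∑ i, (η i : ℝ) ^ 2 + 2 * ∑ i, (ξ i : ℝ) * η i := by
    rw [bracket_sq, Finset.mul_sum, add_assoc, add_assoc, ← Finset.sum_add_distrib,
      ← Finset.sum_add_distrib]
    congr 1
    refine Finset.sum_congr rfl fun i _ => ?_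
    simp only [Pi.add_apply, Int.cast_add]
    ring
  refine (pow_le_pow_iff_left₀ (bracket_pos _).le
    (add_pos (bracket_pos ξ) (bracket_pos η)).le two_ne_zero).1 ?_
  nlinarith [bracket_sq ξ, bracket_sq η]

lemma abs_apply_le_bracket {d : ℕ} (ξ : Fin d → ℤ) (i : Fin d) : |(ξ i : ℝ)| ≤ bracket ξ := by
  refine Real.abs_le_sqrt ?_
  have := Finset.single_le_sum (f := fun i => (ξ i : ℝ) ^ 2) (fun j _ => sq_nonneg _)
    (Finset.mem_univ i)
  linarith

lemma sum_range_succ_rpow_le {p : ℝ} (hp : 0 < p) (hp1 : p ≤ 1) (N : ℕ) :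
    ∑ k ∈ Finset.range N, ((k : ℝ) + 1) ^ (p - 1) ≤ (N : ℝ) ^ p / p := by
  induction N with
  | zero => simp [hp.ne']
  | succ N ih =>
    rw [Finset.sum_range_succ]
    have hN : (0 : ℝ) < (N : ℝ) + 1 := by positivity
    have hb := rpow_one_add_le_one_add_mul_self (s := -1 / ((N : ℝ) + 1))
      (by rw [le_div_iff₀ hN]; have : (0 : ℝ) ≤ N := N.cast_nonneg; linarith) hp.le hp1
    have hs : 1 + -1 / ((N : ℝ) + 1) = N / (N + 1) := by field_simp; ring
    rw [hs, Real.div_rpow N.cast_nonneg hN.le, div_le_iff₀ (by positivity)] at hb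
    have hpow : ((N : ℝ) + 1) ^ (p - 1) = ((N : ℝ) + 1) ^ p / (N + 1) := by
      rw [Real.rpow_sub hN, Real.rpow_one]
    have : (N : ℝ) ^ p / p ≤ ((N : ℝ) + 1) ^ p / p - ((N : ℝ) + 1) ^ (p - 1) := by
      rw [hpow, div_le_iff₀ hp]
      refine hb.trans (le_of_eq ?_)
      field_simp
      ring
    push_cast
    linarith

lemma sum_Icc_one_add_sq_rpow_le {p R : ℝ} (hp : 0 < p) (hp1 : p ≤ 1) (hR : 1 ≤ R) :
    ∑ n ∈ Finset.Icc (-(⌊R⌋₊ : ℤ)) ⌊R⌋₊, (1 + (n : ℝ) ^ 2) ^ ((p - 1) / 2) ≤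
      (1 + 2 / p) * R ^ p := by
  have hterm (k : ℕ) : (1 + (((k + 1 : ℕ) : ℤ) : ℝ) ^ 2) ^ ((p - 1) / 2) ≤
      ((k : ℝ) + 1) ^ (p - 1) := by
    have hk : (0 : ℝ) < (k : ℝ) + 1 := by positivity
    calc (1 + (((k + 1 : ℕ) : ℤ) : ℝ) ^ 2) ^ ((p - 1) / 2)
        ≤ (((k : ℝ) + 1) ^ 2) ^ ((p - 1) / 2) := by
          refine Real.rpow_le_rpow_of_nonpos (by positivity) ?_ (by linarith)
          push_cast; linarith
      _ = ((k : ℝ) + 1) ^ (p - 1) := by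
          rw [← Real.rpow_natCast, ← Real.rpow_mul hk.le]
          congr 1; push_cast; ring
  rw [Finset.sum_Icc_of_even_eq_range (fun n => by simp), Finset.sum_range_succ']
  have h1 := (Finset.sum_le_sum fun k (_ : k ∈ Finset.range ⌊R⌋₊) => hterm k).trans
    (sum_range_succ_rpow_le hp hp1 ⌊R⌋₊)
  have h2 : (⌊R⌋₊ : ℝ) ^ p / p ≤ R ^ p / p := by
    gcongr
    exact Nat.floor_le (by linarith)
  have h3 : 1 ≤ R ^ p := Real.one_le_rpow hR hp.le
  have h4 : (1 + 2 / p) * R ^ p = R ^ p + 2 * (R ^ p / p) := by ring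
  rw [h4, two_smul]
  norm_num at h1 ⊢
  linarith

/-- Lattice points in a ball, weighted by a non-positive power of the bracket. -/
lemma sum_piFinset_bracket_rpow_le {d : ℕ} (hd : 0 < d) {r R : ℝ} (hr : -(d : ℝ) < r)
    (hr0 : r ≤ 0) (hR : 1 ≤ R) :
    ∑ ξ ∈ Fintype.piFinset fun _ : Fin d => Finset.Icc (-(⌊R⌋₊ : ℤ)) ⌊R⌋₊, bracket ξ ^ r ≤
      (1 + 2 / (1 + r / d)) ^ d * R ^ (d + r) := by
  have hd' : (0 : ℝ) < d := by exact_mod_cast hd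
  have hp : 0 < 1 + r / d := by
    have : -1 < r / d := by rw [lt_div_iff₀ hd']; linarith
    linarith
  have hp1 : 1 + r / d ≤ 1 := by
    have : r / d ≤ 0 := div_nonpos_of_nonpos_of_nonneg hr0 hd'.le
    linarith
  have hterm (ξ : Fin d → ℤ) :
      bracket ξ ^ r ≤ ∏ i, (1 + (ξ i : ℝ) ^ 2) ^ ((1 + r / d - 1) / 2) := by
    calc bracket ξ ^ r = ∏ _i : Fin d, (bracket ξ ^ 2) ^ ((1 + r / d - 1) / 2) := by
          rw [Finset.prod_const, Finset.card_univ, Fintype.card_fin, ← Real.rpow_natCast,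
            ← Real.rpow_natCast, ← Real.rpow_mul (bracket_pos ξ).le,
            ← Real.rpow_mul (bracket_pos ξ).le]
          congr 1; push_cast; field_simp; ring
      _ ≤ _ := by
          refine Finset.prod_le_prod (fun i _ => by positivity) fun i _ => ?_
          refine Real.rpow_le_rpow_of_nonpos (by positivity) ?_ (by linarith)
          have := Finset.single_le_sum (f := fun i => (ξ i : ℝ) ^ 2) (fun j _ => sq_nonneg _)
            (Finset.mem_univ i)
          rw [bracket_sq]
          simpa using this
  refine (Finset.sum_le_sum fun ξ _ => hterm ξ).trans ?_
  rw [← Finset.prod_univ_sum (fun _ => Finset.Icc (-(⌊R⌋₊ : ℤ)) ⌊R⌋₊)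
    (fun _ n => (1 + (n : ℝ) ^ 2) ^ ((1 + r / d - 1) / 2)), Finset.prod_const, Finset.card_univ,
    Fintype.card_fin]
  refine (pow_le_pow_left₀ (Finset.sum_nonneg fun n _ => by positivity)
    (sum_Icc_one_add_sq_rpow_le hp hp1 hR) d).trans (le_of_eq ?_)
  rw [mul_pow, ← Real.rpow_natCast (R ^ _), ← Real.rpow_mul (by linarith)]
  congr 2; field_simp

/-- `⟨ξ⟩` as an extended nonnegative real. -/
noncomputable def ebracket {d : ℕ} (ξ : Fin d → ℤ) : ℝ≥0∞ := ENNReal.ofReal (bracket ξ)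

lemma ebracket_ne_zero {d : ℕ} (ξ : Fin d → ℤ) : ebracket ξ ≠ 0 := by
  simp [ebracket, bracket_pos ξ]

lemma ebracket_ne_top {d : ℕ} (ξ : Fin d → ℤ) : ebracket ξ ≠ ⊤ := ENNReal.ofReal_ne_top

lemma ebracket_le_iff {d : ℕ} (ξ η : Fin d → ℤ) :
    ebracket ξ ≤ ebracket η ↔ bracket ξ ≤ bracket η :=
  ENNReal.ofReal_le_ofReal_iff (bracket_pos η).le

lemma ebracket_neg {d : ℕ} (ξ : Fin d → ℤ) : ebracket (-ξ) = ebracket ξ := by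
  rw [ebracket, bracket_neg, ebracket]

lemma ebracket_add_le {d : ℕ} (ξ η : Fin d → ℤ) :
    ebracket (ξ + η) ≤ ebracket ξ + ebracket η := by
  unfold ebracket
  rw [← ENNReal.ofReal_add (bracket_pos ξ).le (bracket_pos η).le]
  exact ENNReal.ofReal_le_ofReal (bracket_add_le ξ η)

lemma ebracket_rpow {d : ℕ} (ξ : Fin d → ℤ) (t : ℝ) :
    ebracket ξ ^ t = ENNReal.ofReal (bracket ξ ^ t) :=
  ENNReal.ofReal_rpow_of_pos (bracket_pos ξ)

lemma ebracket_rpow_add {d : ℕ} (ξ : Fin d → ℤ) (t u : ℝ) :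
    ebracket ξ ^ (t + u) = ebracket ξ ^ t * ebracket ξ ^ u :=
  ENNReal.rpow_add _ _ (ebracket_ne_zero ξ) (ebracket_ne_top ξ)

lemma ebracket_rpow_sq {d : ℕ} (ξ : Fin d → ℤ) (t : ℝ) :
    (ebracket ξ ^ t) ^ 2 = ebracket ξ ^ (2 * t) := by
  rw [sq, ← ebracket_rpow_add, two_mul]

/-- The sum of `⟨ξ⟩ʳ` over `⟨ξ⟩ ≤ ⟨η⟩` is `O(⟨η⟩^{d + r})` for `r > -d`. -/
lemma exists_tsum_ebracket_rpow_le {d : ℕ} (hd : 0 < d) {r : ℝ} (hr : -(d : ℝ) < r) :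
    ∃ C : ℝ≥0∞, C ≠ ⊤ ∧ ∀ η : Fin d → ℤ,
      ∑' ξ : Fin d → ℤ, (if ebracket ξ ≤ ebracket η then ebracket ξ ^ r else 0) ≤
        C * ebracket η ^ (d + r) := by
  have hd' : (0 : ℝ) < d := by exact_mod_cast hd
  set q : ℝ := min r 0 with hq
  have hqd : -(d : ℝ) < q := lt_min hr (by linarith)
  refine ⟨ENNReal.ofReal ((1 + 2 / (1 + q / d)) ^ d), ENNReal.ofReal_ne_top, fun η => ?_⟩
  set S := Fintype.piFinset fun _ : Fin d =>
    Finset.Icc (-(⌊bracket η⌋₊ : ℤ)) ⌊bracket η⌋₊ with hS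
  have hmem (ξ : Fin d → ℤ) (h : bracket ξ ≤ bracket η) : ξ ∈ S := by
    refine Fintype.mem_piFinset.2 fun i => ?_
    have h1 : (((ξ i).natAbs : ℕ) : ℝ) ≤ bracket η := by
      rw [Nat.cast_natAbs, Int.cast_abs]
      exact (abs_apply_le_bracket ξ i).trans h
    have h2 := Nat.le_floor h1
    rw [Finset.mem_Icc]
    omega
  rw [tsum_eq_sum (s := S) fun ξ hξ =>
    if_neg fun h => hξ (hmem ξ ((ebracket_le_iff ξ η).1 h))]
  have hterm (ξ : Fin d → ℤ) : (if ebracket ξ ≤ ebracket η then ebracket ξ ^ r else 0) ≤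
      ENNReal.ofReal (bracket η ^ (r - q) * bracket ξ ^ q) := by
    split_ifs with h
    · rw [ebracket_rpow]
      refine ENNReal.ofReal_le_ofReal ?_
      have hξ : bracket ξ ^ r = bracket ξ ^ (r - q) * bracket ξ ^ q := by
        rw [← Real.rpow_add (bracket_pos ξ), sub_add_cancel]
      rw [hξ]
      have := bracket_pos ξ
      gcongr
      · exact sub_nonneg.2 (min_le_left _ _)
      · exact (ebracket_le_iff ξ η).1 h
    · exact zero_le
  refine (Finset.sum_le_sum fun ξ _ => hterm ξ).trans ?_
  have hη := bracket_pos η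
  rw [← ENNReal.ofReal_sum_of_nonneg fun ξ _ => by have := bracket_pos ξ; positivity,
    ebracket_rpow, ← ENNReal.ofReal_mul' (by positivity), ← Finset.mul_sum]
  refine ENNReal.ofReal_le_ofReal ?_
  refine (mul_le_mul_of_nonneg_left (sum_piFinset_bracket_rpow_le hd hqd (min_le_right _ _)
    (one_le_bracket η)) (by positivity)).trans (le_of_eq ?_)
  rw [mul_left_comm, ← Real.rpow_add hη]
  congr 2; ring

namespace ENNReal

/-- Cauchy–Schwarz for series. -/
lemma sq_tsum_mul_le {ι : Type*} (u v : ι → ℝ≥0∞) :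
    (∑' i, u i * v i) ^ 2 ≤ (∑' i, u i ^ 2) * ∑' i, v i ^ 2 := by
  have key : ∑' i, u i * v i ≤ (∑' i, u i ^ 2) ^ (1 / 2 : ℝ) * (∑' i, v i ^ 2) ^ (1 / 2 : ℝ) := by
    rw [ENNReal.tsum_eq_iSup_sum]
    refine iSup_le fun S => (ENNReal.inner_le_Lp_mul_Lq S u v
      Real.HolderConjugate.two_two).trans ?_
    simp only [ENNReal.rpow_two]
    gcongr <;> exact ENNReal.sum_le_tsum _
  calc (∑' i, u i * v i) ^ 2 ≤ _ := pow_le_pow_left₀ zero_le key 2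
    _ = _ := by
      rw [mul_pow, ← ENNReal.rpow_two, ← ENNReal.rpow_two, ← ENNReal.rpow_mul,
        ← ENNReal.rpow_mul]
      norm_num

lemma add_add_sq_le (x y z : ℝ≥0∞) : (x + y + z) ^ 2 ≤ 9 * (x ^ 2 + y ^ 2 + z ^ 2) := by
  have hm : (max (max x y) z) ^ 2 ≤ x ^ 2 + y ^ 2 + z ^ 2 := by
    rcases max_cases (max x y) z with ⟨h, -⟩ | ⟨h, -⟩ <;> rw [h]
    · rcases max_cases x y with ⟨h, -⟩ | ⟨h, -⟩ <;> rw [h, add_assoc]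
      · exact le_self_add
      · exact le_self_add.trans le_add_self
    · exact le_add_self
  calc (x + y + z) ^ 2 ≤ (3 * max (max x y) z) ^ 2 := by
        refine pow_le_pow_left₀ zero_le ?_ 2
        have : (3 : ℝ≥0∞) * max (max x y) z =
            max (max x y) z + max (max x y) z + max (max x y) z := by ring
        rw [this]
        gcongr
        · exact (le_max_left x y).trans (le_max_left _ _)
        · exact (le_max_right x y).trans (le_max_left _ _)
        · exact le_max_right _ _
    _ = 9 * (max (max x y) z) ^ 2 := by ring
    _ ≤ _ := by gcongr

lemma rpow_le_two_rpow_abs_mul {x y : ℝ≥0∞} (hx : x ≠ 0) (hx' : x ≠ ⊤) (hxy : x ≤ 2 * y)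
    (hyx : y ≤ 2 * x) (t : ℝ) : x ^ t ≤ 2 ^ |t| * y ^ t := by
  rcases le_total 0 t with ht | ht
  · rw [abs_of_nonneg ht, ← ENNReal.mul_rpow_of_nonneg _ _ ht]
    exact ENNReal.rpow_le_rpow hxy ht
  · have hy' : y ≠ ⊤ := ne_top_of_le_ne_top (ENNReal.mul_ne_top (by norm_num) hx') hyx
    have hy : y ≠ 0 := fun h => hx (by simpa [h] using hxy)
    have h1 : y ^ (-t) ≤ 2 ^ (-t) * x ^ (-t) := by
      rw [← ENNReal.mul_rpow_of_nonneg _ _ (neg_nonneg.2 ht)]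
      exact ENNReal.rpow_le_rpow hyx (neg_nonneg.2 ht)
    rw [abs_of_nonpos ht]
    calc x ^ t = x ^ t * (y ^ (-t) * y ^ t) := by
          rw [← ENNReal.rpow_add _ _ hy hy', neg_add_cancel, ENNReal.rpow_zero, mul_one]
      _ ≤ x ^ t * (2 ^ (-t) * x ^ (-t) * y ^ t) := by gcongr
      _ = x ^ t * x ^ (-t) * (2 ^ (-t) * y ^ t) := by ring
      _ = 2 ^ (-t) * y ^ t := by
          rw [← ENNReal.rpow_add _ _ hx hx', add_neg_cancel, ENNReal.rpow_zero, one_mul]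

end ENNReal

section KernelBounds

variable {G : Type*} [AddCommGroup G]

lemma tsum_tsum_mul_sub (u v : G → ℝ≥0∞) :
    ∑' ζ, ∑' ξ, u ξ * v (ζ - ξ) = (∑' ξ, u ξ) * ∑' ξ, v ξ := by
  rw [ENNReal.tsum_comm, ← ENNReal.tsum_mul_right]
  refine tsum_congr fun ξ => ?_
  rw [ENNReal.tsum_mul_left, ← (Equiv.subRight ξ).tsum_eq v]
  rfl

lemma tsum_sq_kernel_le_of_row {K : G → G → ℝ≥0∞} {M : ℝ≥0∞}
    (hK : ∀ ζ, ∑' ξ, K ζ ξ ^ 2 ≤ M) (u v : G → ℝ≥0∞) :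
    ∑' ζ, (∑' ξ, K ζ ξ * (u ξ * v (ζ - ξ))) ^ 2 ≤ M * ((∑' ξ, u ξ ^ 2) * ∑' ξ, v ξ ^ 2) := by
  rw [← tsum_tsum_mul_sub, ← ENNReal.tsum_mul_left]
  refine ENNReal.tsum_le_tsum fun ζ => (ENNReal.sq_tsum_mul_le _ _).trans ?_
  simp only [mul_pow]
  gcongr
  exact hK ζ

lemma tsum_sq_kernel_le_of_column {K : G → G → ℝ≥0∞} {M : ℝ≥0∞}
    (hK : ∀ ξ, ∑' ζ, K ζ ξ ^ 2 ≤ M) (u v : G → ℝ≥0∞) :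
    ∑' ζ, (∑' ξ, K ζ ξ * (u ξ * v (ζ - ξ))) ^ 2 ≤ M * ((∑' ξ, u ξ ^ 2) * ∑' ξ, v ξ ^ 2) := by
  calc ∑' ζ, (∑' ξ, K ζ ξ * (u ξ * v (ζ - ξ))) ^ 2
      ≤ ∑' ζ, (∑' ξ, K ζ ξ ^ 2 * u ξ ^ 2) * ∑' ξ, v ξ ^ 2 := by
        refine ENNReal.tsum_le_tsum fun ζ => ?_
        simp only [← mul_assoc]
        refine (ENNReal.sq_tsum_mul_le _ _).trans (le_of_eq ?_)
        simp only [mul_pow]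
        rw [← (Equiv.subLeft ζ).tsum_eq fun ξ => v ξ ^ 2]
        rfl
    _ = (∑' ξ, (∑' ζ, K ζ ξ ^ 2) * u ξ ^ 2) * ∑' ξ, v ξ ^ 2 := by
        rw [ENNReal.tsum_mul_right, ENNReal.tsum_comm]
        simp only [ENNReal.tsum_mul_right]
    _ ≤ (∑' ξ, M * u ξ ^ 2) * ∑' ξ, v ξ ^ 2 := by
        gcongr with ξ
        exact hK ξ
    _ = _ := by rw [ENNReal.tsum_mul_left, mul_assoc]

end KernelBounds

/-- Convolution of nonnegative functions on `ℤᵈ`. -/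
noncomputable def latticeConv {d : ℕ} (u v : (Fin d → ℤ) → ℝ≥0∞) : (Fin d → ℤ) → ℝ≥0∞ :=
  fun ζ => ∑' ξ, u ξ * v (ζ - ξ)

/-- The square of the `Hˢ` norm, for nonnegative Fourier coefficients. -/
noncomputable def sobSq {d : ℕ} (s : ℝ) (u : (Fin d → ℤ) → ℝ≥0∞) : ℝ≥0∞ :=
  ∑' ξ, (ebracket ξ ^ s * u ξ) ^ 2

/-- According to which of `ξ`, `ζ - ξ`, `ζ` has the smallest bracket, the multiplier
of the convolution estimate is controlled by one of three simple kernels. -/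
lemma ebracket_kernel_le {d : ℕ} (a b c : ℝ) (ζ ξ : Fin d → ℤ) :
    ebracket ζ ^ c * ebracket ξ ^ (-a) * ebracket (ζ - ξ) ^ (-b) ≤
      (2 ^ |a| + 2 ^ |b|) *
        ((if ebracket ξ ≤ ebracket ζ then ebracket ξ ^ (-a) * ebracket ζ ^ (c - b) else 0) +
        (if ebracket (ζ - ξ) ≤ ebracket ζ then
          ebracket (ζ - ξ) ^ (-b) * ebracket ζ ^ (c - a) else 0) +
        (if ebracket ζ ≤ ebracket ξ then ebracket ζ ^ c * ebracket ξ ^ (-a - b) else 0)) := by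
  have hζ : ebracket ζ ≤ ebracket ξ + ebracket (ζ - ξ) := by
    simpa using ebracket_add_le ξ (ζ - ξ)
  have hξ : ebracket ξ ≤ ebracket ζ + ebracket (ζ - ξ) := by
    have := ebracket_add_le ζ (-(ζ - ξ))
    rwa [ebracket_neg, ← sub_eq_add_neg, sub_sub_cancel] at this
  have hη : ebracket (ζ - ξ) ≤ ebracket ζ + ebracket ξ := by
    simpa [ebracket_neg, ← sub_eq_add_neg] using ebracket_add_le ζ (-ξ)
  have hcmp {x y z : Fin d → ℤ} (hx : ebracket x ≤ ebracket y + ebracket z)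
      (hy : ebracket y ≤ ebracket x + ebracket z) (hzx : ebracket z ≤ ebracket x)
      (hzy : ebracket z ≤ ebracket y) (t : ℝ) :
      ebracket x ^ (-t) ≤ 2 ^ |t| * ebracket y ^ (-t) := by
    rw [← abs_neg t]
    refine ENNReal.rpow_le_two_rpow_abs_mul (ebracket_ne_zero x) (ebracket_ne_top x) ?_ ?_ _
    · rw [two_mul]; exact hx.trans (by gcongr)
    · rw [two_mul]; exact hy.trans (by gcongr)
  by_cases h1 : ebracket ξ ≤ ebracket ζ ∧ ebracket ξ ≤ ebracket (ζ - ξ)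
  · rw [if_pos h1.1]
    calc ebracket ζ ^ c * ebracket ξ ^ (-a) * ebracket (ζ - ξ) ^ (-b)
        ≤ ebracket ζ ^ c * ebracket ξ ^ (-a) * (2 ^ |b| * ebracket ζ ^ (-b)) := by
          gcongr
          exact hcmp hη (by rwa [add_comm]) h1.2 h1.1 b
      _ = 2 ^ |b| * (ebracket ξ ^ (-a) * ebracket ζ ^ (c - b)) := by
          rw [sub_eq_add_neg, ebracket_rpow_add]; ring
      _ ≤ _ := by
          gcongr
          · exact le_add_self
          · rw [add_assoc]; exact le_self_add
  by_cases h2 : ebracket (ζ - ξ) ≤ ebracket ζ ∧ ebracket (ζ - ξ) ≤ ebracket ξ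
  · rw [if_pos h2.1]
    calc ebracket ζ ^ c * ebracket ξ ^ (-a) * ebracket (ζ - ξ) ^ (-b)
        ≤ ebracket ζ ^ c * (2 ^ |a| * ebracket ζ ^ (-a)) * ebracket (ζ - ξ) ^ (-b) := by
          gcongr
          exact hcmp hξ hζ h2.2 h2.1 a
      _ = 2 ^ |a| * (ebracket (ζ - ξ) ^ (-b) * ebracket ζ ^ (c - a)) := by
          rw [sub_eq_add_neg c a, ebracket_rpow_add]; ring
      _ ≤ _ := by
          gcongr
          · exact le_self_add
          · exact le_add_self.trans le_self_add
  have h3 : ebracket ζ ≤ ebracket ξ ∧ ebracket ζ ≤ ebracket (ζ - ξ) := by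
    grind
  rw [if_pos h3.1]
  calc ebracket ζ ^ c * ebracket ξ ^ (-a) * ebracket (ζ - ξ) ^ (-b)
      ≤ ebracket ζ ^ c * ebracket ξ ^ (-a) * (2 ^ |b| * ebracket ξ ^ (-b)) := by
        gcongr
        exact hcmp (by rwa [add_comm]) (by rwa [add_comm]) h3.2 h3.1 b
    _ = 2 ^ |b| * (ebracket ζ ^ c * ebracket ξ ^ (-a - b)) := by
        rw [sub_eq_add_neg (-a), ebracket_rpow_add]; ring
    _ ≤ _ := by
        gcongr
        · exact le_add_self
        · exact le_add_self

/-- Uniform square-summability in `ξ` of the kernel `⟨ξ⟩ᵗ ⟨η⟩ᵘ` restricted to `⟨ξ⟩ ≤ ⟨η⟩`,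
at the scaling exponent. -/
lemma exists_tsum_kernel_sq_le {d : ℕ} (hd : 0 < d) {t u : ℝ} (ht : -((d : ℝ) / 2) < t)
    (htu : t + u = -((d : ℝ) / 2)) :
    ∃ C : ℝ≥0∞, C ≠ ⊤ ∧ ∀ η : Fin d → ℤ,
      ∑' ξ : Fin d → ℤ,
        (if ebracket ξ ≤ ebracket η then ebracket ξ ^ t * ebracket η ^ u else 0) ^ 2 ≤ C := by
  obtain ⟨C, hC, h⟩ := exists_tsum_ebracket_rpow_le hd (r := 2 * t) (by linarith)
  refine ⟨C, hC, fun η => ?_⟩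
  calc ∑' ξ : Fin d → ℤ,
        (if ebracket ξ ≤ ebracket η then ebracket ξ ^ t * ebracket η ^ u else 0) ^ 2
      = (∑' ξ : Fin d → ℤ, if ebracket ξ ≤ ebracket η then ebracket ξ ^ (2 * t) else 0) *
          ebracket η ^ (2 * u) := by
        rw [← ENNReal.tsum_mul_right]
        refine tsum_congr fun ξ => ?_
        split_ifs <;> simp [mul_pow, ebracket_rpow_sq]
    _ ≤ C * ebracket η ^ (d + 2 * t) * ebracket η ^ (2 * u) := by gcongr; exact h η
    _ = C := by
        rw [mul_assoc, ← ebracket_rpow_add, show (d : ℝ) + 2 * t + 2 * u = 0 by linarith,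
          ENNReal.rpow_zero, mul_one]

/-- The bilinear product estimate `Hᵃ · Hᵇ ⊆ H^{a + b - d/2}`. -/
theorem exists_sobSq_latticeConv_le {d : ℕ} (hd : 0 < d) {a b c : ℝ} (ha : a < (d : ℝ) / 2)
    (hb : b < (d : ℝ) / 2) (hab : 0 < a + b) (hc : c = a + b - (d : ℝ) / 2) :
    ∃ C : ℝ≥0∞, C ≠ ⊤ ∧ ∀ u v : (Fin d → ℤ) → ℝ≥0∞,
      sobSq c (latticeConv u v) ≤ C * (sobSq a u * sobSq b v) := by
  obtain ⟨A, hA, hKA⟩ := exists_tsum_kernel_sq_le hd (t := -a) (u := c - b) (by linarith)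
    (by linarith)
  obtain ⟨B, hB, hKB⟩ := exists_tsum_kernel_sq_le hd (t := -b) (u := c - a) (by linarith)
    (by linarith)
  obtain ⟨D, hD, hKD⟩ := exists_tsum_kernel_sq_le hd (t := c) (u := -a - b) (by linarith)
    (by linarith)
  have hP : (2 ^ |a| + 2 ^ |b| : ℝ≥0∞) ≠ ⊤ := by
    simp [ENNReal.rpow_eq_top_iff]
  set P : ℝ≥0∞ := 2 ^ |a| + 2 ^ |b|
  refine ⟨9 * P ^ 2 * (A + B + D), by finiteness, fun u v => ?_⟩
  set U : (Fin d → ℤ) → ℝ≥0∞ := fun ξ => ebracket ξ ^ a * u ξ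
  set V : (Fin d → ℤ) → ℝ≥0∞ := fun ξ => ebracket ξ ^ b * v ξ
  set KA : (Fin d → ℤ) → (Fin d → ℤ) → ℝ≥0∞ := fun ζ ξ =>
    if ebracket ξ ≤ ebracket ζ then ebracket ξ ^ (-a) * ebracket ζ ^ (c - b) else 0
  set KB : (Fin d → ℤ) → (Fin d → ℤ) → ℝ≥0∞ := fun ζ ξ =>
    if ebracket (ζ - ξ) ≤ ebracket ζ then ebracket (ζ - ξ) ^ (-b) * ebracket ζ ^ (c - a) else 0
  set KD : (Fin d → ℤ) → (Fin d → ℤ) → ℝ≥0∞ := fun ζ ξ =>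
    if ebracket ζ ≤ ebracket ξ then ebracket ζ ^ c * ebracket ξ ^ (-a - b) else 0
  have hrowB (ζ : Fin d → ℤ) : ∑' ξ, KB ζ ξ ^ 2 ≤ B := by
    refine le_of_eq_of_le ?_ (hKB ζ)
    exact (Equiv.subLeft ζ).tsum_eq fun ξ =>
      (if ebracket ξ ≤ ebracket ζ then ebracket ξ ^ (-b) * ebracket ζ ^ (c - a) else 0) ^ 2
  have hinv (x : Fin d → ℤ) (t : ℝ) (w : ℝ≥0∞) : w = ebracket x ^ (-t) * (ebracket x ^ t * w) := by
    rw [← mul_assoc, ← ebracket_rpow_add, neg_add_cancel, ENNReal.rpow_zero, one_mul]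
  have hpt (ζ : Fin d → ℤ) : ebracket ζ ^ c * latticeConv u v ζ ≤
      P * (∑' ξ, KA ζ ξ * (U ξ * V (ζ - ξ)) + ∑' ξ, KB ζ ξ * (U ξ * V (ζ - ξ)) +
        ∑' ξ, KD ζ ξ * (U ξ * V (ζ - ξ))) := by
    rw [latticeConv, ← ENNReal.tsum_mul_left, ← ENNReal.tsum_add, ← ENNReal.tsum_add,
      ← ENNReal.tsum_mul_left]
    refine ENNReal.tsum_le_tsum fun ξ => ?_
    calc ebracket ζ ^ c * (u ξ * v (ζ - ξ))
        = ebracket ζ ^ c * ebracket ξ ^ (-a) * ebracket (ζ - ξ) ^ (-b) * (U ξ * V (ζ - ξ)) := by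
          conv_lhs => rw [hinv ξ a (u ξ), hinv (ζ - ξ) b (v (ζ - ξ))]
          ring
      _ ≤ P * (KA ζ ξ + KB ζ ξ + KD ζ ξ) * (U ξ * V (ζ - ξ)) := by
          exact mul_le_mul_left (ebracket_kernel_le a b c ζ ξ) _
      _ = _ := by ring
  calc sobSq c (latticeConv u v)
      ≤ ∑' ζ, 9 * P ^ 2 * ((∑' ξ, KA ζ ξ * (U ξ * V (ζ - ξ))) ^ 2 +
          (∑' ξ, KB ζ ξ * (U ξ * V (ζ - ξ))) ^ 2 + (∑' ξ, KD ζ ξ * (U ξ * V (ζ - ξ))) ^ 2) := by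
        refine ENNReal.tsum_le_tsum fun ζ => (pow_le_pow_left₀ zero_le (hpt ζ) 2).trans ?_
        rw [mul_pow, mul_comm 9, mul_assoc]
        gcongr
        exact ENNReal.add_add_sq_le _ _ _
    _ ≤ 9 * P ^ 2 * (A * (sobSq a u * sobSq b v) + B * (sobSq a u * sobSq b v) +
          D * (sobSq a u * sobSq b v)) := by
        rw [ENNReal.tsum_mul_left, ENNReal.tsum_add, ENNReal.tsum_add]
        gcongr
        · exact tsum_sq_kernel_le_of_row hKA U V
        · exact tsum_sq_kernel_le_of_row hrowB U V
        · exact tsum_sq_kernel_le_of_column hKD U V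
    _ = _ := by ring

lemma sobNorm_eq_sobSq {d : ℕ} (s : ℝ) (f : (Fin d → ℤ) → ℂ) :
    sobNorm d s f = sobSq s (fun ξ => ‖f ξ‖ₑ) ^ (1 / 2 : ℝ) := by
  unfold sobNorm sobSq
  congr 1
  refine tsum_congr fun ξ => ?_
  rw [mul_pow, ebracket_rpow_sq, ebracket_rpow, ENNReal.ofReal_mul (by unfold sobWeight; positivity),
    ENNReal.ofReal_pow (norm_nonneg _), ofReal_norm, sobWeight, Real.rpow_mul (bracket_pos ξ).le,
    Real.rpow_two, bracket_sq]

lemma enorm_quintProd_le {d : ℕ} (f₁ f₂ f₃ f₄ f₅ : (Fin d → ℤ) → ℂ) (ξ : Fin d → ℤ) :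
    ‖quintProd d f₁ f₂ f₃ f₄ f₅ ξ‖ₑ ≤
      latticeConv (fun η => ‖f₁ η‖ₑ) (latticeConv (fun η => ‖f₂ η‖ₑ)
        (latticeConv (fun η => ‖f₃ η‖ₑ) (latticeConv (fun η => ‖f₄ η‖ₑ)
          fun η => ‖f₅ η‖ₑ))) ξ := by
  refine enorm_tsum_le_tsum_enorm.trans (le_of_eq ?_)
  simp only [latticeConv, ← ENNReal.tsum_mul_left, enorm_mul]
  simp only [ENNReal.tsum_prod', mul_assoc]

/-- For `s ∈ (-d/2, d/2)` and `f₁,…,f₅ ∈ H^{(s+2d)/5}(𝕋ᵈ)`,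
`‖f₁ f₂ f₃ f₄ f₅‖_{Hˢ} ≲ ∏ ‖f_j‖_{H^{(s+2d)/5}}`, constant depending only on `s, d`. -/
theorem stmt_3 (d : ℕ) (hd : 0 < d) (s : ℝ)
    (hs₁ : -((d : ℝ)/2) < s) (hs₂ : s < (d : ℝ)/2) :
    ∃ C : ℝ, 0 < C ∧ ∀ f₁ f₂ f₃ f₄ f₅ : (Fin d → ℤ) → ℂ,
      sobNorm d ((s + 2*d)/5) f₁ ≠ ⊤ → sobNorm d ((s + 2*d)/5) f₂ ≠ ⊤ →
      sobNorm d ((s + 2*d)/5) f₃ ≠ ⊤ → sobNorm d ((s + 2*d)/5) f₄ ≠ ⊤ →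
      sobNorm d ((s + 2*d)/5) f₅ ≠ ⊤ →
      sobNorm d s (quintProd d f₁ f₂ f₃ f₄ f₅) ≤
        ENNReal.ofReal C * sobNorm d ((s + 2*d)/5) f₁ * sobNorm d ((s + 2*d)/5) f₂ *
          sobNorm d ((s + 2*d)/5) f₃ * sobNorm d ((s + 2*d)/5) f₄ *
          sobNorm d ((s + 2*d)/5) f₅ := by
  have hd' : (0 : ℝ) < d := by exact_mod_cast hd
  obtain ⟨σ, hσ⟩ : ∃ σ : ℝ, σ = (s + 2 * d) / 5 := ⟨_, rfl⟩
  rw [← hσ]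
  obtain ⟨C₂, hC₂, h₂⟩ := exists_sobSq_latticeConv_le hd (a := σ) (b := σ)
    (c := 2 * σ - d / 2) (by linarith) (by linarith) (by linarith) (by ring)
  obtain ⟨C₃, hC₃, h₃⟩ := exists_sobSq_latticeConv_le hd (a := σ) (b := 2 * σ - d / 2)
    (c := 3 * σ - d) (by linarith) (by linarith) (by linarith) (by ring)
  obtain ⟨C₄, hC₄, h₄⟩ := exists_sobSq_latticeConv_le hd (a := σ) (b := 3 * σ - d)
    (c := 4 * σ - 3 * d / 2) (by linarith) (by linarith) (by linarith) (by ring)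
  obtain ⟨C₅, hC₅, h₅⟩ := exists_sobSq_latticeConv_le hd (a := σ) (b := 4 * σ - 3 * d / 2)
    (c := s) (by linarith) (by linarith) (by linarith) (by linarith)
  set M : ℝ≥0∞ := (C₅ * C₄ * C₃ * C₂) ^ (1 / 2 : ℝ) with hM
  have hM' : M ≠ ⊤ := ENNReal.rpow_ne_top_of_nonneg (by norm_num) (by finiteness)
  refine ⟨M.toReal + 1, by positivity, fun f₁ f₂ f₃ f₄ f₅ _ _ _ _ _ => ?_⟩
  have hMC : M ≤ ENNReal.ofReal (M.toReal + 1) := by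
    rw [← ENNReal.ofReal_toReal hM']
    exact ENNReal.ofReal_le_ofReal (by simp)
  simp only [sobNorm_eq_sobSq]
  set F₁ : (Fin d → ℤ) → ℝ≥0∞ := fun ξ => ‖f₁ ξ‖ₑ
  set F₂ : (Fin d → ℤ) → ℝ≥0∞ := fun ξ => ‖f₂ ξ‖ₑ
  set F₃ : (Fin d → ℤ) → ℝ≥0∞ := fun ξ => ‖f₃ ξ‖ₑ
  set F₄ : (Fin d → ℤ) → ℝ≥0∞ := fun ξ => ‖f₄ ξ‖ₑ
  set F₅ : (Fin d → ℤ) → ℝ≥0∞ := fun ξ => ‖f₅ ξ‖ₑ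
  have hmain : sobSq s (fun ξ => ‖quintProd d f₁ f₂ f₃ f₄ f₅ ξ‖ₑ) ≤
      C₅ * C₄ * C₃ * C₂ * sobSq σ F₁ * sobSq σ F₂ * sobSq σ F₃ * sobSq σ F₄ * sobSq σ F₅ := by
    calc _ ≤ sobSq s (latticeConv F₁ (latticeConv F₂ (latticeConv F₃ (latticeConv F₄ F₅)))) := by
          refine ENNReal.tsum_le_tsum fun ξ => ?_
          gcongr
          exact enorm_quintProd_le f₁ f₂ f₃ f₄ f₅ ξ
      _ ≤ C₅ * (sobSq σ F₁ * (C₄ * (sobSq σ F₂ * (C₃ * (sobSq σ F₃ *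
          (C₂ * (sobSq σ F₄ * sobSq σ F₅))))))) := by
          refine (h₅ _ _).trans ?_
          gcongr
          refine (h₄ _ _).trans ?_
          gcongr
          refine (h₃ _ _).trans ?_
          gcongr
          exact h₂ _ _
      _ = _ := by ring
  calc _ ≤ _ := ENNReal.rpow_le_rpow hmain (by norm_num : (0 : ℝ) ≤ 1 / 2)
    _ = M * sobSq σ F₁ ^ (1 / 2 : ℝ) * sobSq σ F₂ ^ (1 / 2 : ℝ) * sobSq σ F₃ ^ (1 / 2 : ℝ) *
        sobSq σ F₄ ^ (1 / 2 : ℝ) * sobSq σ F₅ ^ (1 / 2 : ℝ) := by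
      simp only [hM, ENNReal.mul_rpow_of_nonneg _ _ (by norm_num : (0 : ℝ) ≤ 1 / 2)]
    _ ≤ _ := by gcongr
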